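/- Let G be a connected finite simple graph, let S be a configuration of G with |S| = k, and let 𝒴 be a family of pairwise disjoint nonempty vertex subsets of G with |𝒴| ≤ k such that every transversal of 𝒴 (a set containing exactly one vertex from each Y ∈ 𝒴 and nothing else) is a minimal feedback vertex set of G. Then for every natural number b, the following are equivalent: (1) there exists an injection μ : 𝒴 → S with ∑_{Y ∈ 𝒴} min_{y ∈ Y} dist(μ(Y), y) ≤ b; (2) there exists a feedback vertex set F of G that is reachable from S in at most b token-sliding steps and a minimal feedback vertex set F' ⊆ F with |F' ∩ Y| = 1 for every Y ∈ 𝒴. -/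

import Mathlib

/-- Two configurations (sets of tokens) are adjacent if one is obtained from the
other by sliding a single token along an edge. -/
def ConfigAdj {V : Type*} [DecidableEq V] (G : SimpleGraph V) (S S' : Finset V) : Prop :=
  ∃ x ∈ S, ∃ y ∉ S, G.Adj x y ∧ S' = insert y (S.erase x)

/-- `T` is reachable from `S` in at most `b` token-sliding steps. -/
def ReachableIn {V : Type*} [DecidableEq V] (G : SimpleGraph V) (S T : Finset V) (b : ℕ) : Prop :=
  ∃ (ℓ : ℕ) (f : ℕ → Finset V), ℓ ≤ b ∧ f 0 = S ∧ f ℓ = T ∧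
    ∀ i < ℓ, ConfigAdj G (f i) (f (i + 1))

/-- `F` is a feedback vertex set of `G`: the subgraph induced on the complement
of `F` is acyclic. -/
def IsFVS {V : Type*} (G : SimpleGraph V) (F : Finset V) : Prop :=
  (G.induce ((↑F : Set V)ᶜ)).IsAcyclic

/-- `F` is a minimal feedback vertex set of `G`: it is a feedback vertex set and
no proper subset of it is a feedback vertex set. -/
def MinimalFVS {V : Type*} (G : SimpleGraph V) (F : Finset V) : Prop :=
  IsFVS G F ∧ ∀ F' ⊂ F, ¬ IsFVS G F'

theorem IsFVS.mono {V : Type*} {G : SimpleGraph V} {F F' : Finset V} (h : F ⊆ F')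
    (hF : IsFVS G F) : IsFVS G F' :=
  SimpleGraph.IsAcyclic.comap
    (G.induceHomOfLE (Set.compl_subset_compl.mpr (Finset.coe_subset.mpr h))).toHom
    (G.induceHomOfLE (Set.compl_subset_compl.mpr (Finset.coe_subset.mpr h))).injective hF

section TokenSliding

variable {V : Type*} [DecidableEq V] {G : SimpleGraph V}

theorem ReachableIn.refl (S : Finset V) (b : ℕ) : ReachableIn G S S b :=
  ⟨0, fun _ => S, Nat.zero_le _, rfl, rfl, by simp⟩

theorem ReachableIn.cons {S S' F : Finset V} {b : ℕ} (h : ConfigAdj G S S')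
    (hr : ReachableIn G S' F b) : ReachableIn G S F (b + 1) := by
  obtain ⟨l, f, hl, h0, hF, hf⟩ := hr
  refine ⟨l + 1, fun i => Nat.casesOn i S f, by omega, rfl, hF, ?_⟩
  rintro (_ | i) hi
  · simpa [h0] using h
  · exact hf i (by omega)

/-- Reassigning targets by swapping `x = m t` with a vertex `y` that is not assigned to any target
lowers the total distance when `y` is closer to `t` than `x`. -/
theorem sum_dist_swap_lt {T : Finset V} {m : V → V} (hm : Set.InjOn m T) {t y : V} (ht : t ∈ T)
    (hy : ∀ u ∈ T, m u ≠ y) (hd : G.dist y t < G.dist (m t) t) :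
    ∑ u ∈ T, G.dist (Equiv.swap (m t) y (m u)) u < ∑ u ∈ T, G.dist (m u) u := by
  refine Finset.sum_lt_sum (fun u hu => ?_) ⟨t, ht, by simpa using hd⟩
  by_cases hut : u = t
  · subst hut
    simpa using hd.le
  · rw [Equiv.swap_apply_of_ne_of_ne (fun h => hut (hm hu ht h)) (hy u hu)]

/-- Swapping the tokens assigned to `t` and `t'` does not increase the total distance if the token
of `t'` lies next to that of `t`, one step closer to `t`. -/
theorem sum_dist_swap_le (hG : G.Connected) {T : Finset V} {m : V → V} (hm : Set.InjOn m T)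
    {t t' : V} (ht : t ∈ T) (ht' : t' ∈ T) (hadj : G.Adj (m t) (m t'))
    (hd : G.dist (m t') t + 1 = G.dist (m t) t) :
    ∑ u ∈ T, G.dist (Equiv.swap (m t) (m t') (m u)) u ≤ ∑ u ∈ T, G.dist (m u) u := by
  have hne : t' ≠ t := fun h => hadj.ne (by rw [h])
  have ht'' : t' ∈ T.erase t := Finset.mem_erase.mpr ⟨hne, ht'⟩
  rw [← Finset.add_sum_erase _ _ ht, ← Finset.add_sum_erase _ _ ht'',
    ← Finset.add_sum_erase T _ ht, ← Finset.add_sum_erase (T.erase t) _ ht'']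
  have hrest : ∑ u ∈ (T.erase t).erase t', G.dist (Equiv.swap (m t) (m t') (m u)) u =
      ∑ u ∈ (T.erase t).erase t', G.dist (m u) u := by
    refine Finset.sum_congr rfl fun u hu => ?_
    simp only [Finset.mem_erase] at hu
    rw [Equiv.swap_apply_of_ne_of_ne (fun h => hu.2.1 (hm hu.2.2 ht h))
      (fun h => hu.1 (hm hu.2.2 ht' h))]
  have htri := hG.dist_triangle (u := m t) (v := m t') (w := t')
  rw [SimpleGraph.dist_eq_one_iff_adj.mpr hadj] at htri
  rw [hrest, Equiv.swap_apply_left, Equiv.swap_apply_right]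
  omega

/-- In a connected graph, tokens assigned injectively to targets can be slid so as to cover all
the targets within the total distance of the assignment. -/
theorem exists_reachableIn_of_sum_dist_le (hG : G.Connected) (T : Finset V) (n : ℕ) :
    ∀ (S : Finset V) (m : V → V), Set.InjOn m T → (∀ u ∈ T, m u ∈ S) →
      ∑ u ∈ T, G.dist (m u) u ≤ n → ∃ F, T ⊆ F ∧ ReachableIn G S F n := by
  induction n with
  | zero =>
    intro S m hm hS hsum
    refine ⟨S, fun u hu => ?_, .refl S 0⟩
    have h := (Finset.sum_eq_zero_iff.mp (Nat.le_zero.mp hsum)) u hu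
    rw [hG.dist_eq_zero_iff] at h
    exact h ▸ hS u hu
  | succ n ih =>
    intro S m hm hS hsum
    by_cases hTS : T ⊆ S
    · exact ⟨S, hTS, .refl S _⟩
    obtain ⟨t, ht, htS⟩ := Finset.not_subset.mp hTS
    obtain ⟨d, hd⟩ : ∃ d, G.dist (m t) t = d := ⟨_, rfl⟩
    induction d generalizing m with
    | zero =>
      rw [hG.dist_eq_zero_iff] at hd
      exact absurd (hd ▸ hS t ht) htS
    | succ d ihd =>
      obtain ⟨y, hadj, hy⟩ : ∃ y, G.Adj (m t) y ∧ G.dist y t = d := by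
        generalize m t = x at hd
        obtain ⟨p, hp⟩ := hG.exists_walk_length_eq_dist x t
        cases p with
        | nil => simp at hd
        | @cons _ y _ h q =>
          refine ⟨y, h, ?_⟩
          have h1 := SimpleGraph.dist_le q
          have h2 := hG.dist_triangle (u := x) (v := y) (w := t)
          rw [SimpleGraph.dist_eq_one_iff_adj.mpr h] at h2
          rw [SimpleGraph.Walk.length_cons] at hp
          omega
      have hinj : Set.InjOn (fun u => Equiv.swap (m t) y (m u)) T :=
        fun u hu v hv h => hm hu hv ((Equiv.swap (m t) y).injective h)
      by_cases hyS : y ∈ S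
      · refine ihd (fun u => Equiv.swap (m t) y (m u)) hinj (fun u hu => ?_) ?_ (by simpa using hy)
        · rw [Equiv.swap_apply_def]
          split_ifs
          exacts [hyS, hS t ht, hS u hu]
        · by_cases hex : ∃ t' ∈ T, m t' = y
          · obtain ⟨t', ht', rfl⟩ := hex
            exact (sum_dist_swap_le hG hm ht ht' hadj (by omega)).trans hsum
          · push Not at hex
            exact (sum_dist_swap_lt hm ht hex (by omega)).le.trans hsum
      · have hex : ∀ u ∈ T, m u ≠ y := fun u hu h => hyS (h ▸ hS u hu)
        have hlt := sum_dist_swap_lt (G := G) hm ht hex (by omega)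
        obtain ⟨F, hTF, hF⟩ := ih (insert y (S.erase (m t))) _ hinj (fun u hu => by
          by_cases hut : m u = m t
          · simp [hut]
          · rw [Equiv.swap_apply_of_ne_of_ne hut (hex u hu)]
            simp [hut, hS u hu]) (by omega)
        exact ⟨F, hTF, hF.cons ⟨m t, hS t ht, y, hyS, hadj, rfl⟩⟩

/-- Tracing tokens back along a sliding sequence: each token of the final configuration comes from
its own token of the initial one, and the total distance is at most the number of steps. -/
theorem ReachableIn.exists_injOn (hG : G.Connected) {S F : Finset V} {b : ℕ}
    (h : ReachableIn G S F b) :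
    ∃ g : V → V, Set.InjOn g F ∧ (∀ u ∈ F, g u ∈ S) ∧ ∑ u ∈ F, G.dist (g u) u ≤ b := by
  obtain ⟨l, f, hl, h0, hF, hf⟩ := h
  suffices ∃ g : V → V, Set.InjOn g F ∧ (∀ u ∈ F, g u ∈ S) ∧ ∑ u ∈ F, G.dist (g u) u ≤ l by
    obtain ⟨g, h1, h2, h3⟩ := this
    exact ⟨g, h1, h2, h3.trans hl⟩
  clear hl
  induction l generalizing S f with
  | zero => exact ⟨id, Function.injective_id.injOn, by simp [← h0, ← hF], by simp⟩
  | succ l ih =>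
    obtain ⟨g, hg, hgS, hsum⟩ := ih (fun i => f (i + 1)) rfl hF (fun i hi => hf (i + 1) (by omega))
    obtain ⟨x, hx, y, hy, hadj, hS'⟩ := hf 0 (by omega)
    rw [h0] at hx hy hS'
    have hgx : ∀ u ∈ F, g u = y ∨ g u ≠ x ∧ g u ≠ y ∧ g u ∈ S := by
      intro u hu
      have h := hgS u hu
      simp only [zero_add] at h hS'
      rw [hS', Finset.mem_insert, Finset.mem_erase] at h
      by_cases huy : g u = y
      · exact .inl huy
      · exact .inr ⟨(h.resolve_left huy).1, huy, (h.resolve_left huy).2⟩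
    refine ⟨fun u => Equiv.swap x y (g u),
      fun u hu v hv h => hg hu hv ((Equiv.swap x y).injective h), fun u hu => ?_, ?_⟩
    · rcases hgx u hu with h | ⟨h1, h2, h3⟩
      · simpa [h] using hx
      · simpa [Equiv.swap_apply_of_ne_of_ne h1 h2] using h3
    · calc ∑ u ∈ F, G.dist (Equiv.swap x y (g u)) u
          ≤ ∑ u ∈ F, (G.dist (g u) u + if g u = y then 1 else 0) := by
            refine Finset.sum_le_sum fun u hu => ?_
            rcases hgx u hu with h | ⟨h1, h2, -⟩
            · have htri := hG.dist_triangle (u := x) (v := y) (w := u)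
              rw [SimpleGraph.dist_eq_one_iff_adj.mpr hadj] at htri
              simp only [h, Equiv.swap_apply_right, if_true]
              omega
            · simp [Equiv.swap_apply_of_ne_of_ne h1 h2]
        _ ≤ l + 1 := by
            rw [Finset.sum_add_distrib, ← Finset.card_filter]
            refine Nat.add_le_add hsum (Finset.card_le_one.mpr fun u hu v hv => ?_)
            rw [Finset.mem_filter] at hu hv
            exact hg hu.1 hv.1 (hu.2.trans hv.2.symm)

end TokenSliding

theorem stmt_14 {V : Type*} [Fintype V] [DecidableEq V] (G : SimpleGraph V)
    (hG : G.Connected) (k : ℕ) (S : Finset V) (hS : S.card = k)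
    (𝒴 : Finset (Finset V))
    (hdisj : (↑𝒴 : Set (Finset V)).Pairwise fun Y Z => Disjoint Y Z)
    (hne : ∀ Y ∈ 𝒴, Y.Nonempty) (hk : 𝒴.card ≤ k)
    (htrans : ∀ F : Finset V, F ⊆ 𝒴.biUnion id → (∀ Y ∈ 𝒴, (F ∩ Y).card = 1) →
      MinimalFVS G F)
    (b : ℕ) :
    (∃ μ : {Y // Y ∈ 𝒴} → {u // u ∈ S}, Function.Injective μ ∧
      ∑ Y ∈ 𝒴.attach, sInf {d : ℕ | ∃ y ∈ Y.1, G.dist (μ Y).1 y = d} ≤ b) ↔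
    (∃ F : Finset V, IsFVS G F ∧ ReachableIn G S F b ∧
      ∃ F' ⊆ F, MinimalFVS G F' ∧ ∀ Y ∈ 𝒴, (F' ∩ Y).card = 1) := by
  have hinj : ∀ f : {Y // Y ∈ 𝒴} → V, (∀ Y, f Y ∈ Y.1) → Function.Injective f := by
    intro f hf Y Z h
    by_contra hYZ
    have hd := hdisj Y.2 Z.2 (fun h' => hYZ (Subtype.ext h'))
    exact Finset.disjoint_left.mp hd (hf Y) (h ▸ hf Z)
  constructor
  · rintro ⟨μ, hμ, hsum⟩
    have hex : ∀ Y : {Y // Y ∈ 𝒴}, ∃ y ∈ Y.1, G.dist (μ Y).1 y =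
        sInf {d : ℕ | ∃ y ∈ Y.1, G.dist (μ Y).1 y = d} := fun Y => by
      obtain ⟨y, hy⟩ := hne Y.1 Y.2
      exact Nat.sInf_mem (s := {d : ℕ | ∃ y ∈ Y.1, G.dist (μ Y).1 y = d}) ⟨_, y, hy, rfl⟩
    choose f hf hfd using hex
    have hfi := hinj f hf
    set T := 𝒴.attach.image f with hT
    have hTY : ∀ Y ∈ 𝒴, (T ∩ Y).card = 1 := by
      intro Y hY
      refine Finset.card_eq_one.mpr ⟨f ⟨Y, hY⟩, Finset.ext fun v => ?_⟩
      simp only [hT, Finset.mem_inter, Finset.mem_image, Finset.mem_attach, true_and,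
        Finset.mem_singleton]
      constructor
      · rintro ⟨⟨Z, rfl⟩, hv⟩
        by_contra hne'
        have hZY : Z.1 ≠ Y := by
          rintro rfl
          exact hne' rfl
        exact Finset.disjoint_left.mp (hdisj Z.2 hY hZY) (hf Z) hv
      · rintro rfl
        exact ⟨⟨_, rfl⟩, hf ⟨Y, hY⟩⟩
    have hTmin : MinimalFVS G T := by
      refine htrans T (fun v hv => ?_) hTY
      obtain ⟨Y, -, rfl⟩ := Finset.mem_image.mp hv
      exact Finset.mem_biUnion.mpr ⟨Y.1, Y.2, hf Y⟩
    have hm : ∀ Y, Function.extend f (fun Y => (μ Y).1) id (f Y) = (μ Y).1 :=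
      hfi.extend_apply _ _
    obtain ⟨F, hTF, hF⟩ := exists_reachableIn_of_sum_dist_le hG T b S
      (Function.extend f (fun Y => (μ Y).1) id)
      (by
        intro u hu v hv h
        obtain ⟨Y, -, rfl⟩ := Finset.mem_image.mp (Finset.mem_coe.mp hu)
        obtain ⟨Z, -, rfl⟩ := Finset.mem_image.mp (Finset.mem_coe.mp hv)
        rw [hm, hm] at h
        rw [hμ (Subtype.ext h)])
      (by
        intro u hu
        obtain ⟨Y, -, rfl⟩ := Finset.mem_image.mp hu
        rw [hm]
        exact (μ Y).2)
      (by
        rw [hT, Finset.sum_image hfi.injOn]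
        simpa only [hm, hfd] using hsum)
    exact ⟨F, hTmin.1.mono hTF, hF, T, hTF, hTmin, hTY⟩
  · rintro ⟨F, -, hF, F', hF'F, -, hcard⟩
    obtain ⟨g, hg, hgS, hsum⟩ := hF.exists_injOn hG
    have hex : ∀ Y : {Y // Y ∈ 𝒴}, ∃ y, y ∈ F' ∩ Y.1 := fun Y =>
      Finset.card_pos.mp (by rw [hcard Y.1 Y.2]; exact Nat.one_pos)
    choose f hf using hex
    have hfF : ∀ Y, f Y ∈ F := fun Y => hF'F (Finset.mem_inter.mp (hf Y)).1
    have hfY : ∀ Y, f Y ∈ Y.1 := fun Y => (Finset.mem_inter.mp (hf Y)).2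
    have hfi := hinj f hfY
    refine ⟨fun Y => ⟨g (f Y), hgS _ (hfF Y)⟩,
      fun Y Z h => hfi (hg (hfF Y) (hfF Z) (congrArg Subtype.val h)), ?_⟩
    calc _ ≤ ∑ Y ∈ 𝒴.attach, G.dist (g (f Y)) (f Y) :=
          Finset.sum_le_sum fun Y _ => by exact Nat.sInf_le ⟨f Y, hfY Y, rfl⟩
      _ = ∑ u ∈ 𝒴.attach.image f, G.dist (g u) u := by rw [Finset.sum_image hfi.injOn]
      _ ≤ ∑ u ∈ F, G.dist (g u) u :=
          Finset.sum_le_sum_of_subset (Finset.image_subset_iff.mpr fun Y _ => hfF Y)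
      _ ≤ b := hsum
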